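/- For all reals α > 0 and ∇, σ with 0 < |∇| < σ, the function f(x) = σ·√(4α² + x²) − ∇·x on ℝ attains its global minimum at the unique point x* = 2α·∇/√(σ² − ∇²); consequently the solution error of the algebraic equality penalty is |ε| = 2·|∇|·α·√(1/((σ − ∇)·(σ + ∇))). -/

import Mathlib

/-- The minimum value of `σ·√(4α² + x²) − g·x`, attained at `x = 2αg/√(σ² − g²)`. -/
theorem penalized_objective_at_minimizer {α g σ : ℝ} (hα : 0 < α) (h : |g| < σ) :
    σ * Real.sqrt (4 * α ^ 2 + (2 * α * g / Real.sqrt (σ ^ 2 - g ^ 2)) ^ 2) -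
        g * (2 * α * g / Real.sqrt (σ ^ 2 - g ^ 2))
      = 2 * α * Real.sqrt (σ ^ 2 - g ^ 2) := by
  have hσ : 0 < σ := (abs_nonneg g).trans_lt h
  have hd : 0 < σ ^ 2 - g ^ 2 := sub_pos.2 (sq_lt_sq.2 (h.trans_le (le_abs_self σ)))
  have hs2 := Real.sq_sqrt hd.le
  have hs := Real.sqrt_pos.2 hd
  set s := Real.sqrt (σ ^ 2 - g ^ 2)
  have hroot : Real.sqrt (4 * α ^ 2 + (2 * α * g / s) ^ 2) = 2 * α * σ / s := by
    rw [Real.sqrt_eq_iff_mul_self_eq (by positivity) (by positivity)]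
    field_simp
    linear_combination 4 * hs2
  rw [hroot]
  field_simp
  linear_combination -hs2

/-- Away from `x = 2αg/√(σ² − g²)`, the penalized objective exceeds its minimum value. -/
theorem lt_penalized_objective {α g σ x : ℝ} (h : |g| < σ)
    (hx : x ≠ 2 * α * g / Real.sqrt (σ ^ 2 - g ^ 2)) :
    2 * α * Real.sqrt (σ ^ 2 - g ^ 2) < σ * Real.sqrt (4 * α ^ 2 + x ^ 2) - g * x := by
  have hσ : 0 < σ := (abs_nonneg g).trans_lt h
  have hd : 0 < σ ^ 2 - g ^ 2 := sub_pos.2 (sq_lt_sq.2 (h.trans_le (le_abs_self σ)))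
  have hs2 := Real.sq_sqrt hd.le
  have hs := Real.sqrt_pos.2 hd
  set s := Real.sqrt (σ ^ 2 - g ^ 2)
  have hr2 := Real.sq_sqrt (by positivity : 0 ≤ 4 * α ^ 2 + x ^ 2)
  have hne : x * s - 2 * α * g ≠ 0 := fun h0 => hx ((eq_div_iff hs.ne').2 (sub_eq_zero.1 h0))
  have hpos : 0 < (x * s - 2 * α * g) ^ 2 := by positivity
  have hdiff : (σ * Real.sqrt (4 * α ^ 2 + x ^ 2)) ^ 2 - (2 * α * s + g * x) ^ 2
      = (x * s - 2 * α * g) ^ 2 := by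
    linear_combination σ ^ 2 * hr2 - (4 * α ^ 2 + x ^ 2) * hs2
  have hlt : 2 * α * s + g * x < σ * Real.sqrt (4 * α ^ 2 + x ^ 2) :=
    lt_of_pow_lt_pow_left₀ 2 (by positivity) (by linarith)
  linarith

/-- For `α > 0` and `0 < |∇| < σ`, the function `f(x) = σ·√(4α² + x²) − ∇·x`
attains its global minimum at the unique point `x* = 2α·∇/√(σ² − ∇²)`; hence
the algebraic equality penalty solution error is
`|ε| = 2·|∇|·α·√(1/((σ − ∇)·(σ + ∇)))`. -/
theorem algebraic_eq_error (α grad sigma : ℝ) (hα : 0 < α) (hg : 0 < |grad|)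
    (hgs : |grad| < sigma) :
    (∀ x : ℝ,
        sigma * Real.sqrt (4 * α ^ 2 +
            (2 * α * grad / Real.sqrt (sigma ^ 2 - grad ^ 2)) ^ 2) -
          grad * (2 * α * grad / Real.sqrt (sigma ^ 2 - grad ^ 2))
        ≤ sigma * Real.sqrt (4 * α ^ 2 + x ^ 2) - grad * x) ∧
    (∀ x : ℝ, x ≠ 2 * α * grad / Real.sqrt (sigma ^ 2 - grad ^ 2) →
        sigma * Real.sqrt (4 * α ^ 2 +
            (2 * α * grad / Real.sqrt (sigma ^ 2 - grad ^ 2)) ^ 2) -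
          grad * (2 * α * grad / Real.sqrt (sigma ^ 2 - grad ^ 2))
        < sigma * Real.sqrt (4 * α ^ 2 + x ^ 2) - grad * x) ∧
    |2 * α * grad / Real.sqrt (sigma ^ 2 - grad ^ 2)|
      = 2 * |grad| * α * Real.sqrt (1 / ((sigma - grad) * (sigma + grad))) := by
  have hd : 0 < sigma ^ 2 - grad ^ 2 := sub_pos.2 (sq_lt_sq.2 (hgs.trans_le (le_abs_self sigma)))
  have hval := penalized_objective_at_minimizer hα hgs
  refine ⟨fun x => ?_, fun x hx => hval ▸ lt_penalized_objective hgs hx, ?_⟩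
  · by_cases hx : x = 2 * α * grad / Real.sqrt (sigma ^ 2 - grad ^ 2)
    · rw [← hx]
    · exact hval ▸ (lt_penalized_objective hgs hx).le
  · have hfac : (sigma - grad) * (sigma + grad) = sigma ^ 2 - grad ^ 2 := by ring
    rw [hfac, one_div, Real.sqrt_inv, abs_div, abs_of_pos (Real.sqrt_pos.2 hd), abs_mul,
      abs_of_pos (by positivity : 0 < 2 * α)]
    ring
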